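/- Let X be a compact metric space and let (v_i)_{i∈ℕ} be a uniformly bounded sequence of functions v_i : X → ℝ. Define the upper half-relaxed limit v̄(x) := limsup of the function (i, y) ↦ v_i(y) along the product filter atTop ×ˢ 𝓝 x, and the lower half-relaxed limit v̲(x) as the corresponding liminf. If v̄(x) ≤ v̲(x) for every x ∈ X, then v̄ = v̲ =: v, the function v is continuous on X, and v_i converges to v uniformly on X: sup_{x∈X} |v_i(x) − v(x)| → 0 as i → ∞. -/

import Mathlib

open Filter

/-- If `F i y → f x` as `i → p` and `y → x` jointly, for every `x`, then `f` is continuous. -/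
theorem continuous_of_forall_tendsto_prod_nhds {ι X Y : Type*} [TopologicalSpace X]
    [TopologicalSpace Y] [RegularSpace Y] {p : Filter ι} [p.NeBot] {F : ι → X → Y} {f : X → Y}
    (h : ∀ x, Tendsto (fun q : ι × X => F q.1 q.2) (p ×ˢ nhds x) (nhds (f x))) :
    Continuous f := by
  refine continuous_iff_continuousAt.2 fun x =>
    (closed_nhds_basis (f x)).tendsto_right_iff.2 fun K hK => ?_
  have hev : ∀ᶠ y in nhds x, ∀ᶠ i in p, F i y ∈ K :=
    (eventually_swap_iff.1 ((h x).eventually hK.1)).curry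
  filter_upwards [hev] with y hy
  exact hK.2.mem_of_tendsto
    ((h y).comp (tendsto_id.prodMk (tendsto_const_nhds (x := y)))) hy

/-- If `F i y → f x` as `i → p` and `y → x` jointly, for every `x`, then `F` converges to `f`
locally uniformly. -/
theorem tendstoLocallyUniformly_of_forall_tendsto_prod_nhds {ι X Y : Type*} [TopologicalSpace X]
    [UniformSpace Y] {p : Filter ι} [p.NeBot] {F : ι → X → Y} {f : X → Y}
    (h : ∀ x, Tendsto (fun q : ι × X => F q.1 q.2) (p ×ˢ nhds x) (nhds (f x))) :
    TendstoLocallyUniformly F f p :=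
  tendstoLocallyUniformly_iff_forall_tendsto.2 fun x =>
    ((((continuous_of_forall_tendsto_prod_nhds h).tendsto x).comp tendsto_snd).prodMk_nhds
      (h x)).mono_right (nhds_le_uniformity (f x))

/-- Barles–Souganidis mechanism: on a compact metric space, if the upper
half-relaxed limit of a uniformly bounded sequence of functions is below the
lower half-relaxed limit, then the two coincide, the common limit is continuous
and the sequence converges uniformly to it. -/
theorem half_relaxed_limits_uniform_convergence
    {X : Type*} [MetricSpace X] [CompactSpace X]
    (v : ℕ → X → ℝ) (C : ℝ) (hC : ∀ i y, |v i y| ≤ C)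
    (vU vL : X → ℝ)
    (hvU : ∀ x, vU x = limsup (fun p : ℕ × X => v p.1 p.2) (atTop ×ˢ nhds x))
    (hvL : ∀ x, vL x = liminf (fun p : ℕ × X => v p.1 p.2) (atTop ×ˢ nhds x))
    (hle : ∀ x, vU x ≤ vL x) :
    vU = vL ∧ Continuous vU ∧ TendstoUniformly v vU atTop := by
  have hbdd_above (x : X) : (atTop ×ˢ nhds x).IsBoundedUnder (· ≤ ·)
      fun p : ℕ × X => v p.1 p.2 :=
    isBoundedUnder_of ⟨C, fun p => (abs_le.1 (hC p.1 p.2)).2⟩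
  have hbdd_below (x : X) : (atTop ×ˢ nhds x).IsBoundedUnder (· ≥ ·)
      fun p : ℕ × X => v p.1 p.2 :=
    isBoundedUnder_of ⟨-C, fun p => (abs_le.1 (hC p.1 p.2)).1⟩
  have heq : vU = vL := funext fun x => (hle x).antisymm <| by
    rw [hvU, hvL]
    exact liminf_le_limsup (hbdd_above x) (hbdd_below x)
  have htendsto (x : X) :
      Tendsto (fun p : ℕ × X => v p.1 p.2) (atTop ×ˢ nhds x) (nhds (vU x)) :=
    tendsto_of_liminf_eq_limsup ((hvL x).symm.trans (congrFun heq x).symm) (hvU x).symm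
      (hbdd_above x) (hbdd_below x)
  exact ⟨heq, continuous_of_forall_tendsto_prod_nhds htendsto,
    tendstoLocallyUniformly_iff_tendstoUniformly_of_compactSpace.1
      (tendstoLocallyUniformly_of_forall_tendsto_prod_nhds htendsto)⟩
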